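/- If for every i = 1,…,N the blocks satisfy: S_i symmetric with S_i ⪰ 0, R_i + S_i ≺ (1/(2d_i))I, Q_i ≺ −2S_i, and Q_i ≺ −4d_i I, then the global LMI under Laplacian coupling holds: Q − SL − LSᵀ + LRL ≺ 0. -/

import Mathlib

open Matrix Kronecker

/-- Block-diagonal matrix built from `N` blocks of size `a × b`. -/
def blkDiag {N a b : ℕ} (M : Fin N → Matrix (Fin a) (Fin b) ℝ) :
    Matrix (Fin N × Fin a) (Fin N × Fin b) ℝ :=
  Matrix.of fun x y => if x.1 = y.1 then M x.1 x.2 y.2 else 0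

theorem blkDiag_transpose {N a b : ℕ} (M : Fin N → Matrix (Fin a) (Fin b) ℝ) :
    (blkDiag M)ᵀ = blkDiag fun i => (M i)ᵀ := by
  ext ⟨i, k⟩ ⟨j, l⟩
  by_cases h : i = j
  · subst h; simp [blkDiag]
  · simp [blkDiag, h, Ne.symm h]

theorem dotProduct_blkDiag_mulVec {N a b : ℕ} (M : Fin N → Matrix (Fin a) (Fin b) ℝ)
    (x : Fin N × Fin a → ℝ) (y : Fin N × Fin b → ℝ) :
    x ⬝ᵥ blkDiag M *ᵥ y =
      ∑ i, (fun k => x (i, k)) ⬝ᵥ M i *ᵥ (fun k => y (i, k)) := by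
  simp [blkDiag, dotProduct, mulVec, Fintype.sum_prod_type, ite_mul]

theorem kronecker_one_mulVec {N m : ℕ} (A : Matrix (Fin N) (Fin N) ℝ)
    (x : Fin N × Fin m → ℝ) (i : Fin N) (k : Fin m) :
    ((A ⊗ₖ (1 : Matrix (Fin m) (Fin m) ℝ)) *ᵥ x) (i, k) = (A *ᵥ fun j => x (j, k)) i := by
  simp [dotProduct, mulVec, Fintype.sum_prod_type, Matrix.one_apply]

/-- The degree-normalized Laplacian has spectrum in `[0, 2]`, stated without square roots. -/
theorem sum_sq_laplacian_mulVec_div_degree_le {N : ℕ} (A : Matrix (Fin N) (Fin N) ℝ)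
    (hA : A.IsSymm) (hnn : ∀ i j, 0 ≤ A i j) (d : Fin N → ℝ)
    (hd : ∀ i, d i = ∑ j, A i j) (hdpos : ∀ i, 0 < d i) (v : Fin N → ℝ) :
    ∑ i, ((Matrix.diagonal d - A) *ᵥ v) i ^ 2 / d i ≤ 4 * ∑ i, d i * v i ^ 2 := by
  have hlap : ∀ i, ((Matrix.diagonal d - A) *ᵥ v) i = ∑ j, A i j * (v i - v j) := by
    intro i
    rw [Matrix.sub_mulVec, Pi.sub_apply, Matrix.mulVec_diagonal, hd]
    simp [mulVec, dotProduct, mul_sub, Finset.sum_sub_distrib, Finset.sum_mul]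
  have hrow : ∀ i, ((Matrix.diagonal d - A) *ᵥ v) i ^ 2 / d i ≤
      ∑ j, A i j * (2 * v i ^ 2 + 2 * v j ^ 2) := by
    intro i
    have hcs : (∑ j, A i j * (v i - v j)) ^ 2 ≤
        (∑ j, A i j) * ∑ j, A i j * (v i - v j) ^ 2 :=
      Finset.sum_sq_le_sum_mul_sum_of_sq_le_mul _ (fun j _ => hnn i j)
        (fun j _ => mul_nonneg (hnn i j) (sq_nonneg _)) (fun j _ => le_of_eq (by ring))
    rw [div_le_iff₀ (hdpos i), hlap, mul_comm]
    refine hcs.trans ?_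
    rw [← hd]
    refine mul_le_mul_of_nonneg_left ?_ (hdpos i).le
    refine Finset.sum_le_sum fun j _ => mul_le_mul_of_nonneg_left ?_ (hnn i j)
    nlinarith [sq_nonneg (v i + v j)]
  have hfst : ∑ i, ∑ j, A i j * v i ^ 2 = ∑ i, d i * v i ^ 2 := by
    simp_rw [hd, Finset.sum_mul]
  have hsnd : ∑ i, ∑ j, A i j * v j ^ 2 = ∑ i, d i * v i ^ 2 := by
    rw [Finset.sum_comm, ← hfst]
    simp_rw [fun i j => hA.apply i j]
  refine (Finset.sum_le_sum fun i _ => hrow i).trans (le_of_eq ?_)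
  simp_rw [mul_add, Finset.sum_add_distrib, mul_left_comm _ (2 : ℝ), ← Finset.mul_sum]
  rw [hfst, hsnd]
  ring

theorem Matrix.PosSemidef.neg_two_mul_dotProduct_mulVec_sub_le {n : Type*} [Fintype n]
    {S : Matrix n n ℝ} (hS : S.PosSemidef) (u w : n → ℝ) :
    -(2 * (u ⬝ᵥ S *ᵥ w)) - w ⬝ᵥ S *ᵥ w ≤ u ⬝ᵥ S *ᵥ u := by
  have h := hS.dotProduct_mulVec_nonneg (u + w)
  have hsymm : w ⬝ᵥ S *ᵥ u = u ⬝ᵥ S *ᵥ w := by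
    have hT : Sᵀ = S := by simpa [Matrix.IsHermitian] using hS.1
    rw [Matrix.dotProduct_mulVec, ← Matrix.mulVec_transpose, hT, dotProduct_comm]
  simp only [star_trivial, Matrix.mulVec_add, add_dotProduct, dotProduct_add] at h
  linarith

/-- Decentralized condition (d): if `S_i ⪰ 0`, `R_i + S_i ≺ (1/(2d_i))I`, `Q_i ≺ −2S_i` and
`Q_i ≺ −4d_iI`, then `Q − SL − LSᵀ + LRL ≺ 0` under Laplacian coupling. -/
theorem decentralized_LMI_fourth {N m : ℕ}
    (𝒜 : Matrix (Fin N) (Fin N) ℝ)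
    (h𝒜symm : 𝒜.IsSymm) (h𝒜nonneg : ∀ i j, 0 ≤ 𝒜 i j) (h𝒜diag : ∀ i, 𝒜 i i = 0)
    (d : Fin N → ℝ) (hd : ∀ i, d i = ∑ j, 𝒜 i j) (hdpos : ∀ i, 0 < d i)
    (ℒ : Matrix (Fin N) (Fin N) ℝ) (hℒ : ℒ = Matrix.diagonal d - 𝒜)
    (hconn : ∀ v : Fin N → ℝ, ℒ *ᵥ v = 0 → ∃ c : ℝ, v = fun _ => c)
    (L : Matrix (Fin N × Fin m) (Fin N × Fin m) ℝ)
    (hL : L = ℒ ⊗ₖ (1 : Matrix (Fin m) (Fin m) ℝ))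
    (Q S R : Fin N → Matrix (Fin m) (Fin m) ℝ)
    (hQsymm : ∀ i, (Q i).IsSymm) (hRsymm : ∀ i, (R i).IsSymm)
    (hSsymm : ∀ i, (S i).IsSymm)
    (hSpsd : ∀ i, (S i).PosSemidef)
    (hRSub : ∀ i, ((1 / (2 * d i)) • (1 : Matrix (Fin m) (Fin m) ℝ) - (R i + S i)).PosDef)
    (hQS : ∀ i, (-((2 : ℝ) • S i) - Q i).PosDef)
    (hQub : ∀ i, (-((4 * d i) • (1 : Matrix (Fin m) (Fin m) ℝ)) - Q i).PosDef) :
    (-(blkDiag Q - blkDiag S * L - L * (blkDiag S)ᵀ + L * blkDiag R * L)).PosDef := by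
  have hLT : Lᵀ = L := by
    rw [hL, ← Matrix.kroneckerMap_transpose, hℒ, Matrix.transpose_sub,
      Matrix.diagonal_transpose, h𝒜symm.eq, Matrix.transpose_one]
  have hQT : (blkDiag Q)ᵀ = blkDiag Q := by
    rw [blkDiag_transpose]; exact congrArg blkDiag (funext fun i => (hQsymm i).eq)
  have hST : (blkDiag S)ᵀ = blkDiag S := by
    rw [blkDiag_transpose]; exact congrArg blkDiag (funext fun i => (hSsymm i).eq)
  have hRT : (blkDiag R)ᵀ = blkDiag R := by
    rw [blkDiag_transpose]; exact congrArg blkDiag (funext fun i => (hRsymm i).eq)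
  rw [hST]
  refine Matrix.PosDef.of_dotProduct_mulVec_pos ?_ ?_
  · rw [Matrix.IsHermitian, Matrix.conjTranspose_eq_transpose_of_trivial]
    simp only [Matrix.transpose_neg, Matrix.transpose_add, Matrix.transpose_sub,
      Matrix.transpose_mul, hLT, hQT, hST, hRT, Matrix.mul_assoc]
    abel
  intro x hx
  rw [star_trivial]
  set y := L *ᵥ x with hy
  have hLx : ∀ z, x ⬝ᵥ L *ᵥ z = y ⬝ᵥ z := fun z => by
    rw [Matrix.dotProduct_mulVec, ← Matrix.mulVec_transpose, hLT]
  have hSx : y ⬝ᵥ blkDiag S *ᵥ x = x ⬝ᵥ blkDiag S *ᵥ y := by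
    rw [Matrix.dotProduct_mulVec, ← Matrix.mulVec_transpose, hST, dotProduct_comm]
  set X : Fin N → Fin m → ℝ := fun i k => x (i, k) with hX
  set Y : Fin N → Fin m → ℝ := fun i k => y (i, k) with hY
  have hform : x ⬝ᵥ -(blkDiag Q - blkDiag S * L - L * blkDiag S + L * blkDiag R * L) *ᵥ x =
      ∑ i, (-(X i ⬝ᵥ Q i *ᵥ X i) + 2 * (X i ⬝ᵥ S i *ᵥ Y i) - Y i ⬝ᵥ R i *ᵥ Y i) := by
    simp only [Matrix.neg_mulVec, Matrix.add_mulVec, Matrix.sub_mulVec, dotProduct_neg,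
      dotProduct_add, dotProduct_sub, ← Matrix.mulVec_mulVec, hLx, ← hy, hSx]
    simp only [dotProduct_blkDiag_mulVec, Finset.sum_add_distrib, Finset.sum_sub_distrib,
      Finset.sum_neg_distrib, ← Finset.mul_sum]
    ring
  have hQ2 : ∀ i, -(X i ⬝ᵥ Q i *ᵥ X i) ≥ X i ⬝ᵥ S i *ᵥ X i + 2 * (d i * (X i ⬝ᵥ X i)) := by
    intro i
    have h1 := (hQS i).posSemidef.dotProduct_mulVec_nonneg (X i)
    have h2 := (hQub i).posSemidef.dotProduct_mulVec_nonneg (X i)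
    simp only [star_trivial, Matrix.sub_mulVec, Matrix.neg_mulVec, Matrix.smul_mulVec,
      Matrix.one_mulVec, dotProduct_sub, dotProduct_neg, dotProduct_smul, smul_eq_mul] at h1 h2
    linarith
  have hQ2lt : ∀ i, X i ≠ 0 →
      -(X i ⬝ᵥ Q i *ᵥ X i) > X i ⬝ᵥ S i *ᵥ X i + 2 * (d i * (X i ⬝ᵥ X i)) := by
    intro i hi
    have h1 := (hQS i).dotProduct_mulVec_pos hi
    have h2 := (hQub i).dotProduct_mulVec_pos hi
    simp only [star_trivial, Matrix.sub_mulVec, Matrix.neg_mulVec, Matrix.smul_mulVec,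
      Matrix.one_mulVec, dotProduct_sub, dotProduct_neg, dotProduct_smul, smul_eq_mul] at h1 h2
    linarith
  have hR2 : ∀ i, Y i ⬝ᵥ R i *ᵥ Y i ≤ 1 / 2 * (Y i ⬝ᵥ Y i / d i) - Y i ⬝ᵥ S i *ᵥ Y i := by
    intro i
    have h := (hRSub i).posSemidef.dotProduct_mulVec_nonneg (Y i)
    simp only [star_trivial, Matrix.sub_mulVec, Matrix.add_mulVec, Matrix.smul_mulVec,
      Matrix.one_mulVec, dotProduct_sub, dotProduct_add, dotProduct_smul, smul_eq_mul] at h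
    have h' : 1 / (2 * d i) * (Y i ⬝ᵥ Y i) = 1 / 2 * (Y i ⬝ᵥ Y i / d i) := by
      have := (hdpos i).ne'
      field_simp
    linarith
  have hcross := fun i => (hSpsd i).neg_two_mul_dotProduct_mulVec_sub_le (X i) (Y i)
  have hspec : ∑ i, Y i ⬝ᵥ Y i / d i ≤ 4 * ∑ i, d i * (X i ⬝ᵥ X i) := by
    have h : ∀ k, ∑ i, Y i k ^ 2 / d i ≤ 4 * ∑ i, d i * X i k ^ 2 := fun k => by
      have hk : ∀ i, Y i k = ((Matrix.diagonal d - 𝒜) *ᵥ fun j => X j k) i := fun i => by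
        rw [← hℒ, hY, hX, hy, hL]; exact kronecker_one_mulVec ℒ x i k
      simp_rw [hk]
      exact sum_sq_laplacian_mulVec_div_degree_le 𝒜 h𝒜symm h𝒜nonneg d hd hdpos _
    simp only [dotProduct, Finset.sum_div, Finset.mul_sum, ← sq] at h ⊢
    rw [Finset.sum_comm]
    conv_rhs => rw [Finset.sum_comm]
    exact Finset.sum_le_sum fun k _ => h k
  obtain ⟨⟨i₀, k₀⟩, hne⟩ := Function.ne_iff.mp hx
  have hX₀ : X i₀ ≠ 0 := fun h => hne (congrFun h k₀)
  have hlt : ∑ i, (2 * (d i * (X i ⬝ᵥ X i)) - 1 / 2 * (Y i ⬝ᵥ Y i / d i)) <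
      ∑ i, (-(X i ⬝ᵥ Q i *ᵥ X i) + 2 * (X i ⬝ᵥ S i *ᵥ Y i) - Y i ⬝ᵥ R i *ᵥ Y i) := by
    refine Finset.sum_lt_sum (fun i _ => ?_) ⟨i₀, Finset.mem_univ _, ?_⟩
    · linarith [hQ2 i, hR2 i, hcross i]
    · linarith [hQ2lt i₀ hX₀, hR2 i₀, hcross i₀]
  rw [Finset.sum_sub_distrib, ← Finset.mul_sum, ← Finset.mul_sum] at hlt
  rw [hform]
  linarith
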